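/- Let n ≥ 2 be an integer and let β_n ∈ (1,2) satisfy β_n^n = β_n^{n−1} + β_n^{n−2} + ⋯ + β_n + 1 (i.e. β_n is the largest root of x^n − x^{n−1} − ⋯ − x − 1). Then μ_{β_n}([0, β_n − 1]) = (2^n − 2)/(2^n − 1). -/

import Mathlib

open MeasureTheory Filter Topology

/-- `m` is the infinite product on `{0,1}^ℕ` of the uniform measure on two points:
every cylinder of length `n` has mass `2⁻ⁿ`. -/
def IsCoinMeasure (m : Measure (ℕ → Fin 2)) : Prop :=
  IsProbabilityMeasure m ∧
  ∀ (n : ℕ) (w : Fin n → Fin 2),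
    m {x | ∀ j : Fin n, x j.1 = w j} = (2 : ENNReal)⁻¹ ^ n

/-- The coding map `π_β(ε) = (1 - 1/β) ∑_{n≥0} ε_n β^{-n}` of the Bernoulli convolution. -/
noncomputable def piBeta (β : ℝ) (x : ℕ → Fin 2) : ℝ :=
  (1 - 1/β) * ∑' n : ℕ, ((x n : ℕ) : ℝ) / β ^ n

namespace IsCoinMeasure

/-- A set of sequences determined by their first `n` digits. -/
def cylinder (n : ℕ) (w : Fin n → Fin 2) : Set (ℕ → Fin 2) := {x | ∀ j : Fin n, x j.1 = w j}

lemma measurableSet_cylinder (n : ℕ) (w : Fin n → Fin 2) : MeasurableSet (cylinder n w) := by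
  have : cylinder n w = ⋂ j : Fin n, (fun x : ℕ → Fin 2 => x j.1) ⁻¹' {w j} := by
    ext x; simp [cylinder]
  rw [this]
  exact MeasurableSet.iInter fun j => measurable_pi_apply _ (measurableSet_singleton _)

lemma isPiSystem_cylinder : IsPiSystem {s | ∃ n w, s = cylinder n w} := by
  rintro _ ⟨n, w, rfl⟩ _ ⟨k, v, rfl⟩ ⟨y, hy₁, hy₂⟩
  refine ⟨max n k, fun j => y j.1, ?_⟩
  ext x
  simp only [cylinder, Set.mem_inter_iff, Set.mem_ofPred_eq] at *
  constructor
  · rintro ⟨h₁, h₂⟩ ⟨j, hj⟩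
    rcases lt_max_iff.1 hj with h | h
    · exact (h₁ ⟨j, h⟩).trans (hy₁ ⟨j, h⟩).symm
    · exact (h₂ ⟨j, h⟩).trans (hy₂ ⟨j, h⟩).symm
  · intro h
    exact ⟨fun j => (h ⟨j, lt_max_of_lt_left j.2⟩).trans (hy₁ j),
      fun j => (h ⟨j, lt_max_of_lt_right j.2⟩).trans (hy₂ j)⟩

lemma generateFrom_cylinder :
    (MeasurableSpace.pi : MeasurableSpace (ℕ → Fin 2)) =
      MeasurableSpace.generateFrom {s | ∃ n w, s = cylinder n w} := by
  apply le_antisymm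
  · refine iSup_le fun i => ?_
    rintro _ ⟨t, -, rfl⟩
    have : (fun x : ℕ → Fin 2 => x i) ⁻¹' t =
        ⋃ w : {w : Fin (i + 1) → Fin 2 // w (Fin.last i) ∈ t}, cylinder (i + 1) w.1 := by
      ext x
      simp only [Set.mem_preimage, Set.mem_iUnion]
      constructor
      · exact fun h => ⟨⟨fun j => x j.1, h⟩, fun j => rfl⟩
      · rintro ⟨⟨w, hw⟩, h⟩
        have := h (Fin.last i)
        simp only [Fin.val_last] at this
        rwa [this]
    rw [this]
    exact MeasurableSet.iUnion fun w => MeasurableSpace.measurableSet_generateFrom ⟨_, _, rfl⟩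
  · refine MeasurableSpace.generateFrom_le ?_
    rintro _ ⟨n, w, rfl⟩
    exact measurableSet_cylinder n w

lemma eq {m m' : Measure (ℕ → Fin 2)} (h : IsCoinMeasure m) (h' : IsCoinMeasure m') : m = m' := by
  have := h.1
  have := h'.1
  refine ext_of_generate_finite _ generateFrom_cylinder isPiSystem_cylinder ?_ (by simp)
  rintro _ ⟨n, w, rfl⟩
  exact (h.2 n w).trans (h'.2 n w).symm

lemma measurable_shift : Measurable (fun (x : ℕ → Fin 2) n => x (n + 1)) :=
  measurable_pi_lambda _ fun _ => measurable_pi_apply _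

lemma measurableSet_digit (n : ℕ) (a : Fin 2) : MeasurableSet {x : ℕ → Fin 2 | x n = a} :=
  measurableSet_eq_fun (measurable_pi_apply n) measurable_const

lemma shift_restrict {m : Measure (ℕ → Fin 2)} (h : IsCoinMeasure m) (a : Fin 2) :
    IsCoinMeasure
      ((2 : ENNReal) • ((m.restrict {x | x 0 = a}).map fun x n => x (n + 1))) := by
  have key : ∀ (n : ℕ) (w : Fin n → Fin 2),
      ((2 : ENNReal) • ((m.restrict {x | x 0 = a}).map fun x n => x (n + 1)))
        {x | ∀ j : Fin n, x j.1 = w j} = (2 : ENNReal)⁻¹ ^ n := by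
    intro n w
    have hc : MeasurableSet {x : ℕ → Fin 2 | ∀ j : Fin n, x j.1 = w j} :=
      measurableSet_cylinder n w
    rw [Measure.smul_apply, Measure.map_apply measurable_shift hc,
      Measure.restrict_apply (measurable_shift hc)]
    have : (fun (x : ℕ → Fin 2) n => x (n + 1)) ⁻¹' {x | ∀ j : Fin n, x j.1 = w j} ∩
        {x | x 0 = a} = {x | ∀ j : Fin (n + 1), x j.1 = (Fin.cons a w : Fin (n + 1) → Fin 2) j} := by
      ext x
      simp [Fin.forall_fin_succ, and_comm]
    rw [this, h.2, smul_eq_mul, pow_succ', ← mul_assoc,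
      ENNReal.mul_inv_cancel (by simp) (by simp), one_mul]
  exact ⟨⟨by simpa using key 0 Fin.elim0⟩, key⟩

lemma real_digit_inter_shift {m : Measure (ℕ → Fin 2)} (h : IsCoinMeasure m) (a : Fin 2)
    {A : Set (ℕ → Fin 2)} (hA : MeasurableSet A) :
    m.real {x | (fun n => x (n + 1)) ∈ A ∧ x 0 = a} = m.real A / 2 := by
  have e := congrArg (fun ν => ν.real A) ((h.shift_restrict a).eq h)
  simp only [Measure.real, Measure.smul_apply, Measure.map_apply measurable_shift hA,
    Measure.restrict_apply (measurable_shift hA), smul_eq_mul, ENNReal.toReal_mul,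
    ENNReal.toReal_ofNat] at e
  simp only [Measure.real]
  rw [← e, mul_div_cancel_left₀ _ (by norm_num)]
  rfl

lemma real_zero {m : Measure (ℕ → Fin 2)} (h : IsCoinMeasure m) : m {x | ∀ n, x n = 0} = 0 := by
  refine le_antisymm (ge_of_tendsto' (ENNReal.tendsto_pow_atTop_nhds_zero_of_lt_one
    (r := (2 : ENNReal)⁻¹) (by simp)) fun n => ?_) zero_le
  rw [← h.2 n fun _ => 0]
  exact measure_mono fun x hx j => hx j

end IsCoinMeasure

section piBeta

variable {β : ℝ}

lemma digit_div_le (hβ : 1 < β) (x : ℕ → Fin 2) (n : ℕ) :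
    ((x n : ℕ) : ℝ) / β ^ n ≤ (1 / β) ^ n := by
  have : ((x n : ℕ) : ℝ) ≤ 1 := by exact_mod_cast Nat.lt_succ_iff.1 (x n).2
  rw [one_div_pow]
  gcongr

lemma summable_inv_pow (hβ : 1 < β) : Summable fun n : ℕ => (1 / β) ^ n :=
  summable_geometric_of_lt_one (by positivity) ((div_lt_one (by positivity)).2 hβ)

lemma summable_digit_div (hβ : 1 < β) (x : ℕ → Fin 2) :
    Summable fun n => ((x n : ℕ) : ℝ) / β ^ n :=
  (summable_inv_pow hβ).of_nonneg_of_le (fun n => by positivity) (digit_div_le hβ x)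

lemma one_sub_one_div_pos (hβ : 1 < β) : 0 < 1 - 1 / β :=
  sub_pos.2 ((div_lt_one (by positivity)).2 hβ)

lemma piBeta_nonneg (hβ : 1 < β) (x : ℕ → Fin 2) : 0 ≤ piBeta β x :=
  mul_nonneg (one_sub_one_div_pos hβ).le (tsum_nonneg fun n => by positivity)

lemma piBeta_le_one (hβ : 1 < β) (x : ℕ → Fin 2) : piBeta β x ≤ 1 := by
  have hc := one_sub_one_div_pos hβ
  calc piBeta β x ≤ (1 - 1 / β) * ∑' n : ℕ, (1 / β) ^ n :=
        mul_le_mul_of_nonneg_left ((summable_digit_div hβ x).tsum_le_tsum (digit_div_le hβ x)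
          (summable_inv_pow hβ)) hc.le
    _ = 1 := by
        rw [tsum_geometric_of_lt_one (by positivity) (sub_pos.1 hc), mul_inv_cancel₀ hc.ne']

lemma eq_zero_of_piBeta_eq_zero (hβ : 1 < β) {x : ℕ → Fin 2} (h : piBeta β x = 0) (n : ℕ) :
    x n = 0 := by
  have h₀ := (mul_eq_zero.1 h).resolve_left (one_sub_one_div_pos hβ).ne'
  have h₁ := (summable_digit_div hβ x).le_tsum n fun k _ => by positivity
  have h₂ : ((x n : ℕ) : ℝ) ≤ 0 := by
    rw [h₀] at h₁
    have := mul_le_mul_of_nonneg_right h₁ (show 0 ≤ β ^ n by positivity)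
    rwa [div_mul_cancel₀ _ (by positivity), zero_mul] at this
  have h₃ : (x n : ℕ) ≤ 0 := by exact_mod_cast h₂
  exact Fin.ext (Nat.le_zero.1 h₃)

lemma piBeta_eq_shift (hβ : 1 < β) (x : ℕ → Fin 2) :
    piBeta β x = (1 - 1 / β) * (x 0 : ℕ) + piBeta β (fun n => x (n + 1)) / β := by
  have hβ' : β ≠ 0 := by positivity
  have : ∀ n, ((x (n + 1) : ℕ) : ℝ) / β ^ (n + 1) = ((x (n + 1) : ℕ) : ℝ) / β ^ n / β := by
    intro n
    rw [pow_succ, div_div]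
  rw [piBeta, (summable_digit_div hβ x).tsum_eq_zero_add]
  simp only [this, tsum_div_const, piBeta, pow_zero, div_one]
  ring

lemma measurable_piBeta (hβ : 1 < β) : Measurable (piBeta β) := by
  refine Continuous.measurable (continuous_const.mul (continuous_tsum (u := fun n => (1 / β) ^ n)
    (fun n => ?_) (summable_inv_pow hβ) fun n x => ?_))
  · exact ((continuous_of_discreteTopology (f := fun a : Fin 2 => ((a : ℕ) : ℝ))).comp
      (continuous_apply n)).div_const _
  · rw [Real.norm_of_nonneg (by positivity)]
    exact digit_div_le hβ x n

lemma measurableSet_piBeta_gt (hβ : 1 < β) (y : ℝ) : MeasurableSet {x | y < piBeta β x} :=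
  measurableSet_lt measurable_const (measurable_piBeta hβ)

lemma real_piBeta_gt {m : Measure (ℕ → Fin 2)} (hm : IsCoinMeasure m) (hβ : 1 < β) (y : ℝ) :
    m.real {x | y < piBeta β x} =
      m.real {x | β * y < piBeta β x} / 2 + m.real {x | β * y - β + 1 < piBeta β x} / 2 := by
  have := hm.1
  have hmeas := measurableSet_piBeta_gt hβ
  rw [← hm.real_digit_inter_shift 0 (hmeas _), ← hm.real_digit_inter_shift 1 (hmeas _),
    ← measureReal_union]
  · congr 1
    ext x
    have hβ' : 0 < β := by positivity
    have e : β * (1 - 1 / β) = β - 1 := by field_simp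
    have hx : y < piBeta β x ↔
        β * y < (β - 1) * (x 0 : ℕ) + piBeta β (fun n => x (n + 1)) := by
      rw [← mul_lt_mul_iff_right₀ hβ', piBeta_eq_shift hβ x, mul_add, ← mul_assoc, e,
        mul_div_cancel₀ _ hβ'.ne']
    simp only [Set.mem_ofPred_eq, Set.mem_union, hx]
    obtain h | h : x 0 = 0 ∨ x 0 = 1 := Fin.exists_fin_two.1 ⟨x 0, rfl⟩
    · simp [h]
    · simp only [h, Fin.val_one, Nat.cast_one, mul_one, one_ne_zero, and_false, and_true, false_or]
      constructor <;> intro _ <;> linarith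
  · refine Set.disjoint_left.2 ?_
    rintro x ⟨-, h₀⟩ ⟨-, h₁⟩
    simp [h₀] at h₁
  · exact (IsCoinMeasure.measurable_shift (hmeas _)).inter (IsCoinMeasure.measurableSet_digit 0 1)

lemma real_piBeta_gt_of_one_le (m : Measure (ℕ → Fin 2)) (hβ : 1 < β) {y : ℝ} (hy : 1 ≤ y) :
    m.real {x | y < piBeta β x} = 0 := by
  have : {x | y < piBeta β x} = ∅ :=
    Set.eq_empty_of_forall_notMem fun x hx => absurd hx ((piBeta_le_one hβ x).trans hy).not_gt
  simp [this]

lemma real_piBeta_pos {m : Measure (ℕ → Fin 2)} (hm : IsCoinMeasure m) (hβ : 1 < β) :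
    m.real {x | 0 < piBeta β x} = 1 := by
  have := hm.1
  have h : {x | 0 < piBeta β x}ᶜ ⊆ {x | ∀ n, x n = 0} := fun x hx =>
    eq_zero_of_piBeta_eq_zero hβ (le_antisymm (not_lt.1 hx) (piBeta_nonneg hβ x))
  have h₀ : m {x | 0 < piBeta β x}ᶜ = 0 := measure_mono_null h hm.real_zero
  rw [Measure.real, (prob_compl_eq_zero_iff (measurableSet_piBeta_gt hβ 0)).1 h₀,
    ENNReal.toReal_one]

end piBeta

theorem stmt16 (n : ℕ) (hn : 2 ≤ n) (βn : ℝ) (hβ1 : 1 < βn) (hβ2 : βn < 2)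
    (hroot : βn ^ n = ∑ j ∈ Finset.range n, βn ^ j)
    (m : Measure (ℕ → Fin 2)) (hm : IsCoinMeasure m) :
    ((m.map (piBeta βn)) (Set.Icc (0 : ℝ) (βn - 1))).toReal =
      ((2 : ℝ) ^ n - 2) / ((2 : ℝ) ^ n - 1) := by
  have := hm.1
  have hβ0 : 0 < βn := by positivity
  have hpow : βn ^ n * (2 - βn) = 1 := by
    have := geom_sum_mul βn n
    rw [← hroot] at this
    linarith
  have hinv : (βn ^ n)⁻¹ = 2 - βn := inv_eq_of_mul_eq_one_right hpow
  have hgold : 1 ≤ βn * (βn - 1) := by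
    have h₁ : βn ^ 2 * (2 - βn) ≤ 1 := hpow ▸
      mul_le_mul_of_nonneg_right (pow_le_pow_right₀ hβ1.le hn) (by linarith)
    nlinarith
  set H : ℕ → ℝ := fun k => m.real {x | 1 - (βn ^ k)⁻¹ < piBeta βn x} with hH
  have hstep : ∀ k, H (k + 2) = H (k + 1) / 2 := by
    intro k
    have e : βn * (1 - (βn ^ (k + 2))⁻¹) = βn - (βn ^ (k + 1))⁻¹ := by
      field_simp
      ring
    have hle : (βn ^ (k + 1))⁻¹ ≤ βn - 1 := by
      have h₁ : (βn ^ (k + 1))⁻¹ ≤ βn⁻¹ :=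
        inv_anti₀ hβ0 (le_self_pow₀ hβ1.le (Nat.succ_ne_zero k))
      exact h₁.trans ((inv_le_iff_one_le_mul₀ hβ0).2 (by linarith))
    simp only [hH]
    rw [real_piBeta_gt hm hβ1, e, real_piBeta_gt_of_one_le m hβ1 (y := βn - _) (by linarith),
      zero_div, zero_add, show βn - (βn ^ (k + 1))⁻¹ - βn + 1 = 1 - (βn ^ (k + 1))⁻¹ by ring]
  have hiter : ∀ k, H (k + 1) = H 1 / 2 ^ k := by
    intro k
    induction k with
    | zero => simp
    | succ k ih => rw [hstep, ih, pow_succ, div_div]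
  have hone : H 1 = 1 / 2 + H n / 2 := by
    have e : βn * (1 - (βn ^ 1)⁻¹) = 1 - (βn ^ n)⁻¹ := by
      rw [hinv]; field_simp; ring
    simp only [hH]
    rw [real_piBeta_gt hm hβ1, e, show 1 - (βn ^ n)⁻¹ - βn + 1 = 0 by rw [hinv]; ring,
      real_piBeta_pos hm hβ1, add_comm]
  obtain ⟨k, rfl⟩ : ∃ k, n = k + 1 := ⟨n - 1, by omega⟩
  have hk := hiter k
  have hval : m.real (piBeta βn ⁻¹' Set.Icc 0 (βn - 1)) = 1 - H (k + 1) := by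
    have hc : piBeta βn ⁻¹' Set.Icc 0 (βn - 1) =
        {x | 1 - (βn ^ (k + 1))⁻¹ < piBeta βn x}ᶜ := by
      ext x
      simp only [Set.mem_preimage, Set.mem_Icc, piBeta_nonneg hβ1 x, true_and, hinv,
        Set.mem_compl_iff, Set.mem_ofPred_eq, not_lt]
      constructor <;> intro _ <;> linarith
    rw [hc, probReal_compl_eq_one_sub (measurableSet_piBeta_gt hβ1 _)]
  rw [Measure.map_apply (measurable_piBeta hβ1) measurableSet_Icc]
  change m.real _ = _
  rw [hval]
  have h2 : (1 : ℝ) ≤ 2 ^ k := one_le_pow₀ (by norm_num)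
  have hk' : H (k + 1) * 2 ^ k = H 1 := by rw [hk]; field_simp
  rw [eq_div_iff (by rw [pow_succ]; linarith), pow_succ]
  rw [hone] at hk'
  linarith
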